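/- Fix t > 0, r > 0, η ≥ 8qr/t and R > 2ηt/q with R·r(T) ≥ 1. Suppose a potential ξ_T : L_T → (0,∞) satisfies (A) there exists x ∈ L_T(0,r) with η ≤ ξ_T(x) < 2η, (B) ξ_T(y) ≤ η/2 for every y ∈ L_T(0,R) \ {x}, and (S3) there exists x' ∈ L_T with 2R ≤ |x'| ≤ 2R+1 and (2R+1)q/t < ξ_T(x') < 5Rq/(2t), while ξ_T(y) < q|y|/t for every y ∈ L_T with y ∉ B(0,R) and y ≠ x'. Then the PAM lilypad support S = {z ∈ L_T : τ_T(z) ≤ t} satisfies: S ⊆ B(0,R) ∪ (ℝ^d \ B(0,3R/2)), with 0 ∈ S ∩ B(0,R) and x' ∈ S \ B(0,3R/2). In particular S is the union of two nonempty sets separated by ℓ¹-distance at least R/2, so S is disconnected. -/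

import Mathlib

open MeasureTheory ProbabilityTheory Real

noncomputable section

/-- The ℓ¹-norm on `ℝ^d`. -/
def l1 {d : ℕ} (z : Fin d → ℝ) : ℝ := ∑ i, |z i|

/-- Membership in the rescaled lattice `L_T = {z ∈ ℝ^d : r(T) z ∈ ℤ^d}`. -/
def inLatt {d : ℕ} (rT : ℝ) (z : Fin d → ℝ) : Prop := ∀ i, ∃ m : ℤ, rT * z i = (m : ℝ)

/-- The rescaled potential `ξ_T(z) = ξ(r(T) z) / a(T)` built from the environment `ξ` on `ℤ^d`. -/
def envPot {Ω : Type*} {d : ℕ} (aT rT : ℝ) (ξ : (Fin d → ℤ) → Ω → ℝ) (ω : Ω)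
    (z : Fin d → ℝ) : ℝ :=
  ξ (fun i => ⌊rT * z i⌋) ω / aT

/-- The cost `∑_{j=1}^n q|y_{j-1} - y_j| / ξ_T(y_j)` of the path `y 0, …, y n`. -/
def pathCost {d : ℕ} (q : ℝ) (ξT : (Fin d → ℝ) → ℝ) (n : ℕ) (y : ℕ → Fin d → ℝ) : ℝ :=
  ∑ j ∈ Finset.range n, q * l1 (y j - y (j + 1)) / ξT (y (j + 1))

/-- The lilypad hitting time `h_T(z)`. -/
def hitTime {d : ℕ} (q rT : ℝ) (ξT : (Fin d → ℝ) → ℝ) (z : Fin d → ℝ) : ℝ :=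
  sInf {s : ℝ | ∃ n : ℕ, 1 ≤ n ∧ ∃ y : ℕ → Fin d → ℝ,
    (∀ j ≤ n, inLatt rT (y j)) ∧ y 0 = z ∧ y n = 0 ∧ s = pathCost q ξT n y}

/-- The rounding `[x]_T` of `x ∈ ℝ^d` to the lattice `L_T`. -/
def roundT {d : ℕ} (rT : ℝ) (x : Fin d → ℝ) : Fin d → ℝ := fun i => (⌊rT * x i⌋ : ℝ) / rT

/-- The PAM lilypad hitting time `τ_T(z) = inf_y q(|y| + |z-y|)/ξ_T(y)`. -/
def tauT {d : ℕ} (q rT : ℝ) (ξT : (Fin d → ℝ) → ℝ) (z : Fin d → ℝ) : ℝ :=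
  sInf {s : ℝ | ∃ y : Fin d → ℝ, inLatt rT y ∧ s = q * (l1 y + l1 (z - y)) / ξT y}

/-- The BRW lilypad profile `m_T(z,t) = sup_y { ξ_T(y)(t - h_T(y))_+ - q|z-y| }`. -/
def mT {d : ℕ} (q rT : ℝ) (ξT : (Fin d → ℝ) → ℝ) (z : Fin d → ℝ) (t : ℝ) : ℝ :=
  sSup {v : ℝ | ∃ y : Fin d → ℝ, inLatt rT y ∧
    v = ξT y * max (t - hitTime q rT ξT y) 0 - q * l1 (z - y)}

/-- The PAM lilypad profile `λ_T(z,t) = sup_y { ξ_T(y) t - q|y| - q|z-y| } ∨ 0`. -/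
def lamT {d : ℕ} (q rT : ℝ) (ξT : (Fin d → ℝ) → ℝ) (z : Fin d → ℝ) (t : ℝ) : ℝ :=
  max (sSup {v : ℝ | ∃ y : Fin d → ℝ, inLatt rT y ∧
    v = ξT y * t - q * l1 y - q * l1 (z - y)}) 0

/-- `a(T) = (T / log T)^q`. -/
def aOf (q T : ℝ) : ℝ := (T / Real.log T) ^ q

/-- `r(T) = (T / log T)^(q+1)`. -/
def rOf (q T : ℝ) : ℝ := (T / Real.log T) ^ (q + 1)

end

lemma l1_nonneg {d : ℕ} (z : Fin d → ℝ) : 0 ≤ l1 z :=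
  Finset.sum_nonneg fun _ _ => abs_nonneg _

lemma l1_zero {d : ℕ} : l1 (0 : Fin d → ℝ) = 0 := by simp [l1]

lemma l1_sub_comm {d : ℕ} (y z : Fin d → ℝ) : l1 (y - z) = l1 (z - y) := by
  simp only [l1, Pi.sub_apply, abs_sub_comm]

lemma l1_le_add_l1_sub {d : ℕ} (y z : Fin d → ℝ) : l1 y ≤ l1 z + l1 (z - y) := by
  unfold l1
  rw [← Finset.sum_add_distrib]
  refine Finset.sum_le_sum fun i _ => ?_
  have h := abs_sub_abs_le_abs_sub (y i) (z i)
  rw [abs_sub_comm] at h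
  simp only [Pi.sub_apply]
  linarith

lemma inLatt_zero {d : ℕ} (rT : ℝ) : inLatt rT (0 : Fin d → ℝ) := fun _ => ⟨0, by simp⟩

/-- Distinct lattice points are at `ℓ¹`-distance at least the mesh size. -/
lemma inv_le_l1_sub_of_ne {d : ℕ} {rT : ℝ} (hrT : 0 < rT) {y z : Fin d → ℝ}
    (hy : inLatt rT y) (hz : inLatt rT z) (h : z ≠ y) : rT⁻¹ ≤ l1 (z - y) := by
  obtain ⟨i, hi⟩ := Function.ne_iff.mp h
  have hle : |z i - y i| ≤ l1 (z - y) :=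
    Finset.single_le_sum (f := fun j => |(z - y) j|) (fun _ _ => abs_nonneg _)
      (Finset.mem_univ i)
  refine le_trans ?_ hle
  obtain ⟨m, hm⟩ := hz i
  obtain ⟨n, hn⟩ := hy i
  have hmn : m - n ≠ 0 := by
    intro h0
    apply hi
    have : m = n := by omega
    apply mul_left_cancel₀ hrT.ne'
    rw [hm, hn, this]
  have h1 : (1 : ℝ) ≤ |((m - n : ℤ) : ℝ)| := by
    exact_mod_cast Int.one_le_abs hmn
  have h2 : ((m - n : ℤ) : ℝ) = rT * (z i - y i) := by
    push_cast
    linarith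
  rw [h2, abs_mul, abs_of_pos hrT] at h1
  exact (inv_le_iff_one_le_mul₀' hrT).mpr h1

lemma tauT_le {d : ℕ} {q rT : ℝ} {ξT : (Fin d → ℝ) → ℝ} (hq : 0 ≤ q)
    (hpos : ∀ z, inLatt rT z → 0 < ξT z) (z : Fin d → ℝ) {y : Fin d → ℝ} (hy : inLatt rT y) :
    tauT q rT ξT z ≤ q * (l1 y + l1 (z - y)) / ξT y := by
  refine csInf_le ⟨0, ?_⟩ ⟨y, hy, rfl⟩
  rintro s ⟨w, hw, rfl⟩
  exact div_nonneg (mul_nonneg hq (add_nonneg (l1_nonneg _) (l1_nonneg _))) (hpos w hw).le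

lemma le_tauT {d : ℕ} {q rT c : ℝ} {ξT : (Fin d → ℝ) → ℝ} {z : Fin d → ℝ}
    (h : ∀ y, inLatt rT y → c ≤ q * (l1 y + l1 (z - y)) / ξT y) : c ≤ tauT q rT ξT z := by
  refine le_csInf ⟨_, 0, inLatt_zero rT, rfl⟩ ?_
  rintro s ⟨y, hy, rfl⟩
  exact h y hy

/-- A lattice point at which the potential is below `q|y|/t` cannot reach another lattice point
`z` by time `t`, with a margin that does not depend on `y`. -/
lemma hitting_cost_ge {d : ℕ} {q rT t v : ℝ} (hq : 0 < q) (hrT : 0 < rT) (ht : 0 < t)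
    (hv : 0 < v) {y z : Fin d → ℝ} (hy : inLatt rT y) (hz : inLatt rT z) (h : z ≠ y)
    (hvy : v < q * l1 y / t) :
    t * (1 + rT⁻¹ / (l1 z + rT⁻¹)) ≤ q * (l1 y + l1 (z - y)) / v := by
  have hu := inv_le_l1_sub_of_ne hrT hy hz h
  have hm : 0 < rT⁻¹ := inv_pos.mpr hrT
  have htri := l1_le_add_l1_sub y z
  have hz0 := l1_nonneg z
  have hvt : v * t < q * l1 y := (lt_div_iff₀ ht).mp hvy
  have hy0 : 0 < l1 y := by
    by_contra hn
    have := mul_pos hv ht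
    nlinarith
  have hfrac : rT⁻¹ / (l1 z + rT⁻¹) ≤ l1 (z - y) / l1 y := by
    rw [div_le_div_iff₀ (by positivity) hy0]
    nlinarith [mul_le_mul_of_nonneg_left htri hm.le, mul_le_mul_of_nonneg_right hu hz0]
  rw [le_div_iff₀ hv]
  calc t * (1 + rT⁻¹ / (l1 z + rT⁻¹)) * v
      = v * t * (1 + rT⁻¹ / (l1 z + rT⁻¹)) := by ring
    _ ≤ q * l1 y * (1 + l1 (z - y) / l1 y) := by gcongr
    _ = q * (l1 y + l1 (z - y)) := by field_simp

/-- **Lemma 8.3.** Under (A), (B) and (S3), the PAM lilypad support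
`S = {z ∈ L_T : τ_T(z) ≤ t}` is contained in `B(0,R) ∪ (ℝ^d \ B(0,3R/2))`, contains `0`
(inside `B(0,R)`) and `x'` (outside `B(0,3R/2)`), and the two pieces are separated by
ℓ¹-distance at least `R/2`; in particular `S` is disconnected. -/
theorem pam_support_disconnected
    (d : ℕ) (hd : 1 ≤ d) (α : ℝ) (hα : (d : ℝ) < α)
    (q : ℝ) (hq : q = d / (α - d))
    (T : ℝ) (hT : Real.exp 1 < T)
    (rT : ℝ) (hrT : rT = rOf q T)
    (t r η R : ℝ) (ht : 0 < t) (hr : 0 < r)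
    (hη : 8 * q * r / t ≤ η) (hR : 2 * η * t / q < R) (hRrT : 1 ≤ R * rT)
    (ξT : (Fin d → ℝ) → ℝ) (hpos : ∀ z, inLatt rT z → 0 < ξT z)
    (x : Fin d → ℝ) (hxlatt : inLatt rT x) (hxball : l1 x < r)
    (hxlo : η ≤ ξT x) (hxhi : ξT x < 2 * η)
    (hB : ∀ y, inLatt rT y → l1 y < R → y ≠ x → ξT y ≤ η / 2)
    (x' : Fin d → ℝ) (hx'latt : inLatt rT x')
    (hx'lo : 2 * R ≤ l1 x') (hx'hi : l1 x' ≤ 2 * R + 1)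
    (hx'pot1 : (2 * R + 1) * q / t < ξT x') (hx'pot2 : ξT x' < 5 * R * q / (2 * t))
    (hS3 : ∀ y, inLatt rT y → ¬ l1 y < R → y ≠ x' → ξT y < q * l1 y / t) :
    (∀ z, inLatt rT z → tauT q rT ξT z ≤ t → (l1 z < R ∨ ¬ l1 z < 3 * R / 2))
    ∧ (inLatt rT (0 : Fin d → ℝ) ∧ tauT q rT ξT 0 ≤ t ∧ l1 (0 : Fin d → ℝ) < R)
    ∧ (tauT q rT ξT x' ≤ t ∧ ¬ l1 x' < 3 * R / 2)
    ∧ (∀ z₁ z₂ : Fin d → ℝ, inLatt rT z₁ → tauT q rT ξT z₁ ≤ t → l1 z₁ < R →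
        inLatt rT z₂ → tauT q rT ξT z₂ ≤ t → ¬ l1 z₂ < 3 * R / 2 →
        R / 2 ≤ l1 (z₁ - z₂)) := by
  have hd0 : (0 : ℝ) < d := by exact_mod_cast hd
  have hq0 : 0 < q := by
    rw [hq]
    exact div_pos hd0 (by linarith)
  have hη0 : 0 < η := lt_of_lt_of_le (by positivity) hη
  have hRq : 2 * η * t < R * q := (div_lt_iff₀ hq0).mp hR
  have hR0 : 0 < R := lt_trans (by positivity) hR
  have hrT0 : 0 < rT := pos_of_mul_pos_right (lt_of_lt_of_le one_pos hRrT) hR0.le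
  have hx0 : 0 < ξT x := hpos x hxlatt
  have hx'0 : 0 < ξT x' := hpos x' hx'latt
  refine ⟨?_, ⟨inLatt_zero rT, ?_, by rwa [l1_zero]⟩, ⟨?_, by linarith⟩, ?_⟩
  · intro z hz hzt
    by_contra! hcon
    obtain ⟨hz1, hz2⟩ := hcon
    set c₁ := q * R / (2 * η) with hc₁
    set c₂ := q * (l1 x' + l1 (z - x')) / ξT x' with hc₂
    set c₃ := q * l1 z / ξT z with hc₃
    set c₄ := t * (1 + rT⁻¹ / (l1 z + rT⁻¹)) with hc₄
    have hzx' : z ≠ x' := by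
      rintro rfl
      linarith
    have h₁ : t < c₁ := by
      rw [hc₁, lt_div_iff₀ (by positivity)]
      linarith
    have h₂ : t < c₂ := by
      rw [hc₂, lt_div_iff₀ hx'0]
      have h := (lt_div_iff₀ (by positivity)).mp hx'pot2
      have htri := l1_le_add_l1_sub x' z
      have := mul_le_mul_of_nonneg_left
        (show 5 * R / 2 ≤ l1 x' + l1 (z - x') by linarith) hq0.le
      linarith
    have h₃ : t < c₃ := by
      have h := (lt_div_iff₀ ht).mp (hS3 z hz hz1.not_gt hzx')
      rw [hc₃, lt_div_iff₀ (hpos z hz)]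
      linarith
    have h₄ : t < c₄ := by
      have hm : 0 < rT⁻¹ / (l1 z + rT⁻¹) :=
        div_pos (inv_pos.mpr hrT0) (add_pos_of_nonneg_of_pos (l1_nonneg z) (inv_pos.mpr hrT0))
      nlinarith [mul_pos ht hm]
    have hlow : min (min c₁ c₂) (min c₃ c₄) ≤ tauT q rT ξT z := by
      refine le_tauT fun y hy => ?_
      have hy0 := hpos y hy
      by_cases hyR : l1 y < R
      · refine ((min_le_left _ _).trans (min_le_left _ _)).trans ?_
        have hyη : ξT y ≤ 2 * η := by
          by_cases hyx : y = x
          · rw [hyx]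
            exact hxhi.le
          · linarith [hB y hy hyR hyx]
        have htri := l1_le_add_l1_sub z y
        rw [l1_sub_comm y z] at htri
        exact div_le_div₀ (mul_nonneg hq0.le (add_nonneg (l1_nonneg _) (l1_nonneg _)))
          (mul_le_mul_of_nonneg_left (hz1.trans htri) hq0.le) hy0 hyη
      by_cases hyx' : y = x'
      · rw [hyx']
        exact (min_le_left _ _).trans (min_le_right _ _)
      by_cases hzy : z = y
      · refine ((min_le_right _ _).trans (min_le_left _ _)).trans ?_
        rw [← hzy, sub_self, l1_zero, add_zero]
      · exact ((min_le_right _ _).trans (min_le_right _ _)).trans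
          (hitting_cost_ge hq0 hrT0 ht hy0 hy hz hzy (hS3 y hy hyR hyx'))
    exact absurd (hlow.trans hzt) (lt_min (lt_min h₁ h₂) (lt_min h₃ h₄)).not_ge
  · refine (tauT_le hq0.le hpos 0 hxlatt).trans ?_
    rw [l1_sub_comm, sub_zero, div_le_iff₀ hx0]
    have h := (div_le_iff₀ ht).mp hη
    nlinarith [mul_le_mul_of_nonneg_left hxball.le hq0.le,
      mul_le_mul_of_nonneg_left hxlo ht.le, mul_pos hq0 hr]
  · refine (tauT_le hq0.le hpos x' hx'latt).trans ?_
    rw [sub_self, l1_zero, add_zero, div_le_iff₀ hx'0]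
    have h := (div_lt_iff₀ ht).mp hx'pot1
    nlinarith [mul_le_mul_of_nonneg_left hx'hi hq0.le]
  · intro z₁ z₂ _ _ h₁ _ _ h₂
    linarith [l1_le_add_l1_sub z₂ z₁]
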